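/- The axioms M1: ∇(φ∨ψ) ∧ ∇(¬φ∨χ) → ∇φ; M2: •(φ∨ψ) ∧ •(¬φ∨χ) → ∇φ; M3: •(φ∨ψ) ∧ ∇(¬φ∨χ) → ∇φ; and M4: (∘φ ∧ φ) → (Δ(φ∨ψ) ∧ ∘(φ∨ψ)) are valid on every (s)-model, for all L(∇,•)-formulas φ, ψ, χ. -/

import Mathlib

/-- The language L(∇,•) over propositional variables indexed by ℕ. -/
inductive Formula : Type
  | atom : ℕ → Formula
  | neg : Formula → Formula
  | and : Formula → Formula → Formula
  | nabla : Formula → Formula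
  | bullet : Formula → Formula

namespace Formula

/-- Disjunction, defined from ¬ and ∧ as usual. -/
def or (φ ψ : Formula) : Formula := neg ((neg φ).and (neg ψ))

/-- Implication, defined from ¬ and ∧ as usual. -/
def imp (φ ψ : Formula) : Formula := (neg φ).or ψ

/-- Biimplication, defined from ¬ and ∧ as usual. -/
def biimp (φ ψ : Formula) : Formula := (φ.imp ψ).and (ψ.imp φ)

/-- A fixed tautology ⊤. -/
def top : Formula := (atom 0).imp (atom 0)

/-- Δφ := ¬∇φ. -/
def delta (φ : Formula) : Formula := neg (nabla φ)

/-- ∘φ := ¬•φ. -/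
def circ (φ : Formula) : Formula := neg (bullet φ)

end Formula

/-- A neighborhood model. -/
structure NbhdModel : Type 1 where
  S : Type
  ne : Nonempty S
  N : S → Set (Set S)
  V : ℕ → Set S

namespace NbhdModel

/-- The truth set ⟦φ⟧_M of a formula in a neighborhood model. -/
def truthSet (M : NbhdModel) : Formula → Set M.S
  | .atom p => M.V p
  | .neg φ => (M.truthSet φ)ᶜ
  | .and φ ψ => M.truthSet φ ∩ M.truthSet ψ
  | .nabla φ => {s | M.truthSet φ ∉ M.N s ∧ (M.truthSet φ)ᶜ ∉ M.N s}
  | .bullet φ => {s | s ∈ M.truthSet φ ∧ M.truthSet φ ∉ M.N s}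

/-- M,s ⊨ φ. -/
def Sat (M : NbhdModel) (s : M.S) (φ : Formula) : Prop := s ∈ M.truthSet φ

/-- Property (n): N(s) contains the unit. -/
def PropN (M : NbhdModel) : Prop := ∀ s : M.S, (Set.univ : Set M.S) ∈ M.N s

/-- Property (r): N(s) contains its core. -/
def PropR (M : NbhdModel) : Prop := ∀ s : M.S, ⋂₀ (M.N s) ∈ M.N s

/-- Property (i): N(s) is closed under binary intersections. -/
def PropI (M : NbhdModel) : Prop :=
  ∀ (s : M.S) (X Y : Set M.S), X ∈ M.N s → Y ∈ M.N s → X ∩ Y ∈ M.N s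

/-- Property (s): N(s) is supplemented (closed under supersets). -/
def PropS (M : NbhdModel) : Prop :=
  ∀ (s : M.S) (X Y : Set M.S), X ∈ M.N s → X ⊆ Y → Y ∈ M.N s

/-- Property (c): N(s) is closed under complements. -/
def PropC (M : NbhdModel) : Prop :=
  ∀ (s : M.S) (X : Set M.S), X ∈ M.N s → Xᶜ ∈ M.N s

/-- Property (d). -/
def PropD (M : NbhdModel) : Prop :=
  ∀ (s : M.S) (X : Set M.S), X ∈ M.N s → Xᶜ ∉ M.N s

/-- Property (t). -/
def PropT (M : NbhdModel) : Prop :=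
  ∀ (s : M.S) (X : Set M.S), X ∈ M.N s → s ∈ X

/-- Property (b). -/
def PropB (M : NbhdModel) : Prop :=
  ∀ (s : M.S) (X : Set M.S), s ∈ X → {u : M.S | Xᶜ ∉ M.N u} ∈ M.N s

/-- Property (4). -/
def Prop4 (M : NbhdModel) : Prop :=
  ∀ (s : M.S) (X : Set M.S), X ∈ M.N s → {u : M.S | X ∈ M.N u} ∈ M.N s

/-- Property (5). -/
def Prop5 (M : NbhdModel) : Prop :=
  ∀ (s : M.S) (X : Set M.S), X ∉ M.N s → {u : M.S | X ∉ M.N u} ∈ M.N s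

end NbhdModel

namespace NbhdModel

variable (M : NbhdModel) (φ ψ : Formula)

theorem truthSet_or : M.truthSet (φ.or ψ) = M.truthSet φ ∪ M.truthSet ψ := by
  simp [Formula.or, truthSet, Set.compl_inter]

theorem sat_imp (s : M.S) : M.Sat s (φ.imp ψ) ↔ (M.Sat s φ → M.Sat s ψ) := by
  simp [Sat, Formula.imp, truthSet_or, truthSet, imp_iff_not_or]

theorem sat_and (s : M.S) : M.Sat s (φ.and ψ) ↔ M.Sat s φ ∧ M.Sat s ψ := Iff.rfl

variable {M φ}

theorem PropS.truthSet_or_mem (hs : M.PropS) {s : M.S} (h : M.truthSet φ ∈ M.N s) :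
    M.truthSet (φ.or ψ) ∈ M.N s :=
  hs s _ _ h (by rw [truthSet_or]; exact Set.subset_union_left)

theorem PropS.sat_nabla_of_or_notMem (hs : M.PropS) {χ : Formula} {s : M.S}
    (h₁ : M.truthSet (φ.or ψ) ∉ M.N s) (h₂ : M.truthSet (φ.neg.or χ) ∉ M.N s) :
    M.Sat s φ.nabla :=
  ⟨fun h => h₁ (hs.truthSet_or_mem ψ h), fun h => h₂ (hs.truthSet_or_mem (φ := φ.neg) χ h)⟩

end NbhdModel

/-- the axioms M1–M4 are valid on every (s)-model. -/
theorem M_axioms_valid_on_s_models (M : NbhdModel) (hs : M.PropS)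
    (φ ψ χ : Formula) (s : M.S) :
    M.Sat s (((Formula.nabla (φ.or ψ)).and (Formula.nabla (φ.neg.or χ))).imp
      (Formula.nabla φ)) ∧
    M.Sat s (((Formula.bullet (φ.or ψ)).and (Formula.bullet (φ.neg.or χ))).imp
      (Formula.nabla φ)) ∧
    M.Sat s (((Formula.bullet (φ.or ψ)).and (Formula.nabla (φ.neg.or χ))).imp
      (Formula.nabla φ)) ∧
    M.Sat s ((φ.circ.and φ).imp
      ((Formula.delta (φ.or ψ)).and (Formula.circ (φ.or ψ)))) := by
  simp only [NbhdModel.sat_imp, NbhdModel.sat_and]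
  refine ⟨fun h => hs.sat_nabla_of_or_notMem ψ h.1.1 h.2.1,
    fun h => hs.sat_nabla_of_or_notMem ψ h.1.2 h.2.2,
    fun h => hs.sat_nabla_of_or_notMem ψ h.1.2 h.2.1, fun ⟨hc, hφ⟩ => ?_⟩
  have hmem : M.truthSet (φ.or ψ) ∈ M.N s :=
    hs.truthSet_or_mem ψ (by_contra fun h => hc ⟨hφ, h⟩)
  exact ⟨fun h => h.1 hmem, fun h => h.2 hmem⟩
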